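/- arXiv:1603.03565 — 8 statements merged into one kernel-verified Lean document; each statement's English description precedes it below -/
import Mathlib

section
/- Let K be a field and n ≥ 1. Let L, U, D be n×n matrices over K such that L is lower triangular and invertible, U is upper triangular and invertible, D is diagonal and invertible, the diagonal entries of L and U coincide (L_ii = U_ii for all i), and the product L·D⁻¹·U is symmetric (equal to its own transpose). Then L = Uᵀ. -/
open Matrix

/-- Factors of a symmetric product `L * diagonal d * U` of a lower and an upper triangular matrix
with equal diagonals are transposes of each other, over a domain, provided that neither `d` nor the
diagonal of `U` vanishes anywhere. -/
theorem Matrix.eq_transpose_of_isSymm_mul_diagonal_mul {m R : Type*} [Fintype m] [LinearOrder m]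
    [CommRing R] [IsDomain R] {L U : Matrix m m R} {d : m → R}
    (hL : ∀ i j, i < j → L i j = 0) (hU : ∀ i j, j < i → U i j = 0)
    (hd : ∀ i, d i ≠ 0) (hU₀ : ∀ i, U i i ≠ 0) (hdiag : ∀ i, L i i = U i i)
    (hsym : (L * diagonal d * U).IsSymm) : L = Uᵀ := by
  suffices h : ∀ j i, L i j = U j i from Matrix.ext fun i j => h j i
  intro j
  induction j using WellFoundedLT.induction with
  | ind j ih =>
    intro i
    have hij := hsym.apply j i
    rw [mul_apply, mul_apply] at hij
    simp only [mul_diagonal] at hij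
    rw [← Finset.add_sum_erase _ (fun k => L i k * d k * U k j) (Finset.mem_univ j),
      ← Finset.add_sum_erase _ (fun k => L j k * d k * U k i) (Finset.mem_univ j)] at hij
    have hrest : ∑ k ∈ Finset.univ.erase j, L i k * d k * U k j =
        ∑ k ∈ Finset.univ.erase j, L j k * d k * U k i := by
      refine Finset.sum_congr rfl fun k hk => ?_
      rcases lt_or_gt_of_ne (Finset.ne_of_mem_erase hk) with hkj | hjk
      · rw [ih k hkj i, ih k hkj j]
        ring
      · rw [hU k j hjk, hL j k hjk]
        ring
    rw [hrest, add_left_inj, hdiag] at hij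
    refine mul_left_cancel₀ (mul_ne_zero (hU₀ j) (hd j)) ?_
    linear_combination hij

/-- If `L` is lower triangular and invertible, `U` is upper triangular and
invertible, `D` is diagonal and invertible, the diagonals of `L` and `U` coincide, and
`L * D⁻¹ * U` is symmetric, then `L = Uᵀ`. -/
theorem lowerUpper_eq_transpose_of_symm
    {K : Type*} [Field K] {n : ℕ} (hn : 1 ≤ n)
    (L U D : Matrix (Fin n) (Fin n) K)
    (hL : ∀ i j : Fin n, i < j → L i j = 0)
    (hU : ∀ i j : Fin n, j < i → U i j = 0)
    (hD : D.IsDiag)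
    (hLu : IsUnit L.det) (hUu : IsUnit U.det) (hDu : IsUnit D.det)
    (hdiag : ∀ i : Fin n, L i i = U i i)
    (hsym : (L * D⁻¹ * U)ᵀ = L * D⁻¹ * U) :
    L = Uᵀ := by
  have hUdet : U.det = ∏ i, U i i := det_of_isUpperTriangular fun i j hij => hU i j hij
  have hDdet : D.det = ∏ i, D i i := by
    conv_lhs => rw [← hD.diagonal_diag]
    exact det_diagonal
  have hU₀ : ∀ i, U i i ≠ 0 := by
    simpa [hUdet, Finset.prod_ne_zero_iff] using hUu.ne_zero
  have hD₀ : ∀ i, D i i ≠ 0 := by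
    simpa [hDdet, Finset.prod_ne_zero_iff] using hDu.ne_zero
  have hinv : D⁻¹ = diagonal fun i => (D i i)⁻¹ := by
    refine inv_eq_right_inv ?_
    rw [← hD.diagonal_diag, diagonal_mul_diagonal, ← diagonal_one]
    congr 1
    ext i
    simp [hD₀ i]
  rw [hinv] at hsym
  exact eq_transpose_of_isSymm_mul_diagonal_mul hL hU (fun i => inv_ne_zero (hD₀ i)) hU₀ hdiag hsym
end

section
/- Let K be a field, n ≥ 1, A an invertible n×n matrix over K, R an invertible upper triangular n×n matrix over K, and D an invertible diagonal n×n matrix over K such that Aᵀ·A = Rᵀ·D⁻¹·R, and assume additionally that the (n,n) entry of R equals (det A)². Define Θ = A·R⁻¹·D. Then for every i = 1,…,n the entry of Θ in row i of the last column satisfies Θ_{i,n} = (−1)^{n+i} · (det A_{i,n}) · (det A), where A_{i,n} denotes the (n−1)×(n−1) submatrix of A obtained by deleting row i and column n. -/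
open Matrix

/-- In the fraction-free QR decomposition of an invertible `(n+1)×(n+1)`
matrix `A` (so the size is at least 1), where `Aᵀ * A = Rᵀ * D⁻¹ * R` with `R` invertible
upper triangular whose last diagonal entry is `(det A)²` and `D` invertible diagonal,
the matrix `Θ = A * R⁻¹ * D` has last column `Θ_{i,n} = (−1)^(n+i) · det A_{i,n} · det A`,
where `A_{i,n}` is the submatrix of `A` obtained by deleting row `i` and the last column. -/
theorem fractionFree_QR_last_column
    {K : Type*} [Field K] {n : ℕ}
    (A R D : Matrix (Fin (n + 1)) (Fin (n + 1)) K)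
    (hA : IsUnit A.det)
    (hRtri : ∀ i j : Fin (n + 1), j < i → R i j = 0) (hR : IsUnit R.det)
    (hDdiag : D.IsDiag) (hD : IsUnit D.det)
    (hfac : Aᵀ * A = Rᵀ * D⁻¹ * R)
    (hRlast : R (Fin.last n) (Fin.last n) = A.det ^ 2) :
    ∀ i : Fin (n + 1),
      (A * R⁻¹ * D) i (Fin.last n) =
        (-1 : K) ^ (n + (i : ℕ)) *
          (A.submatrix i.succAbove (Fin.last n).succAbove).det * A.det := by
  intro i
  have hΘ : Aᵀ * (A * R⁻¹ * D) = Rᵀ := by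
    rw [← Matrix.mul_assoc, ← Matrix.mul_assoc, hfac, mul_nonsing_inv_cancel_right R _ hR,
      nonsing_inv_mul_cancel_right D _ hD]
  have hadj : A.det • (A * R⁻¹ * D) = A.adjugateᵀ * Rᵀ := by
    rw [← hΘ, ← Matrix.mul_assoc A.adjugateᵀ, ← transpose_mul, mul_adjugate, transpose_smul,
      transpose_one, smul_mul, Matrix.one_mul]
  have hcol : (A.adjugateᵀ * Rᵀ) i (Fin.last n) = A.adjugate (Fin.last n) i * A.det ^ 2 := by
    rw [mul_apply, Fintype.sum_eq_single (Fin.last n)]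
    · simp only [transpose_apply, hRlast]
    · intro k hk
      rw [transpose_apply R, hRtri _ _ (Fin.lt_last_iff_ne_last.mpr hk), mul_zero]
  have hentry := congrFun (congrFun hadj i) (Fin.last n)
  rw [hcol, Matrix.smul_apply, smul_eq_mul, adjugate_fin_succ_eq_det_submatrix, Fin.val_last] at hentry
  apply mul_left_cancel₀ hA.ne_zero
  rw [hentry]
  ring
end

section
/- Let R be a commutative ring, n ≥ 1, and let A, P, S, Q be n×n matrices over R with P and Q invertible, S diagonal with diagonal entries d_1,…,d_n satisfying d_i ∣ d_{i+1} for i = 1,…,n−1, and A = P·S·Q. Then for every k with 1 ≤ k ≤ n and every choice of k rows i_1 < … < i_k and k columns j_1 < … < j_k, the product d_1·d_2⋯d_k divides the k×k minor det(A[i_1,…,i_k; j_1,…,j_k]) of A. -/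
open Matrix

/-- Divisibility of consecutive terms of a finite sequence propagates to all ordered pairs. -/
theorem Fin.dvd_of_le_of_dvd_succ {M : Type*} [Monoid M] {n : ℕ} {d : Fin n → M}
    (hd : ∀ (i : Fin n) (h : (i : ℕ) + 1 < n), d i ∣ d ⟨(i : ℕ) + 1, h⟩)
    {i j : Fin n} (hij : i ≤ j) : d i ∣ d j := by
  obtain ⟨j, hj⟩ := j
  replace hij : (i : ℕ) ≤ j := hij
  induction j, hij using Nat.le_induction with
  | base => exact dvd_rfl
  | succ m _ ih => exact (ih (by omega)).trans (hd ⟨m, by omega⟩ hj)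

theorem Fin.castLE_le_of_strictMono {k n : ℕ} (hkn : k ≤ n) {f : Fin k → Fin n}
    (hf : StrictMono f) (j : Fin k) : Fin.castLE hkn j ≤ f j := by
  obtain ⟨j, hj⟩ := j
  induction j with
  | zero => exact Nat.zero_le _
  | succ m ih =>
    exact Nat.succ_le_of_lt (lt_of_le_of_lt (ih (by omega))
      (hf (a := ⟨m, by omega⟩) (b := ⟨m + 1, hj⟩) (Nat.lt_succ_self m)))

/-- In a divisibility chain, the product of the first `k` terms divides the product of any `k`
terms with distinct indices. -/
theorem Fin.prod_castLE_dvd_prod_of_injective {M : Type*} [CommMonoid M] {k n : ℕ} (hkn : k ≤ n)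
    {d : Fin n → M} (hd : ∀ i j, i ≤ j → d i ∣ d j) {f : Fin k → Fin n}
    (hf : Function.Injective f) : (∏ j, d (Fin.castLE hkn j)) ∣ ∏ j, d (f j) := by
  have hsort : StrictMono (f ∘ Tuple.sort f) :=
    (Tuple.monotone_sort f).strictMono_of_injective (hf.comp (Tuple.sort f).injective)
  rw [← Equiv.prod_comp (Tuple.sort f) fun j => d (f j)]
  exact Finset.prod_dvd_prod_of_dvd _ _ fun j _ =>
    hd _ _ (Fin.castLE_le_of_strictMono hkn hsort j)

/-- The determinant of a product of rectangular matrices, expanded along all choices of inner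
indices. -/
theorem Matrix.det_mul_eq_sum_prod_mul_det_submatrix {R m n : Type*} [CommRing R] [Fintype m]
    [DecidableEq m] [Fintype n] (M : Matrix m n R) (N : Matrix n m R) :
    (M * N).det = ∑ f : m → n, (∏ i, M i (f i)) * (N.submatrix f id).det := by
  classical
  have hrow : M * N = fun i => ∑ l, M i l • N l := by
    ext i j
    simp [Matrix.mul_apply]
  rw [hrow]
  refine (detRowAlternating.toMultilinearMap.map_sum fun i l => M i l • N l).trans ?_
  exact Finset.sum_congr rfl fun f _ =>
    detRowAlternating.toMultilinearMap.map_smul_univ (fun i => M i (f i)) fun i => N (f i)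

/-- If `A = P * S * Q` with `P`, `Q` invertible and
`S = diag(d_1,…,d_n)` with `d_i ∣ d_{i+1}` (Smith normal form), then for every
`1 ≤ k ≤ n` the product `d_1 ⋯ d_k` divides every `k×k` minor of `A`. -/
theorem determinantalDivisor_dvd_minor
    {R : Type*} [CommRing R] {n : ℕ} (hn : 1 ≤ n)
    (A P S Q : Matrix (Fin n) (Fin n) R)
    (d : Fin n → R)
    (hS : S = Matrix.diagonal d)
    (hchain : ∀ (i : Fin n) (h : (i : ℕ) + 1 < n), d i ∣ d ⟨(i : ℕ) + 1, h⟩)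
    (hP : IsUnit P.det) (hQ : IsUnit Q.det)
    (hA : A = P * S * Q)
    (k : ℕ) (hk1 : 1 ≤ k) (hkn : k ≤ n)
    (rows cols : Fin k → Fin n)
    (hrows : StrictMono rows) (hcols : StrictMono cols) :
    (∏ j : Fin k, d (Fin.castLE hkn j)) ∣ (A.submatrix rows cols).det := by
  subst hA hS
  have hminor : (P * diagonal d * Q).submatrix rows cols =
      (P * diagonal d).submatrix rows id * Q.submatrix id cols :=
    submatrix_mul _ _ _ _ _ Function.bijective_id
  rw [hminor, det_mul_eq_sum_prod_mul_det_submatrix]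
  refine Finset.dvd_sum fun f _ => ?_
  by_cases hf : Function.Injective f
  · simp only [submatrix_apply, id_eq, mul_diagonal, Finset.prod_mul_distrib]
    exact ((Fin.prod_castLE_dvd_prod_of_injective hkn
      (fun _ _ => Fin.dvd_of_le_of_dvd_succ hchain) hf).mul_left _).mul_right _
  · obtain ⟨a, b, hab, hne⟩ := Function.not_injective_iff.mp hf
    rw [det_zero_of_row_eq hne (by ext; simp [hab]), mul_zero]
    exact dvd_zero _
end

section
/- Let R be a commutative ring, n ≥ 1, A an n×n matrix over R, and 1 ≤ k ≤ n−1. For indices i, j with k < i, j ≤ n and 0 ≤ m ≤ k, let M_m(i,j) denote the determinant of the (m+1)×(m+1) submatrix of A with rows 1,…,m,i and columns 1,…,m,j, and let p_m denote the leading principal m×m minor of A (with p_0 = 1). Then for all i, j > k: p_{k−1} · M_k(i,j) = M_{k−1}(k,k) · M_{k−1}(i,j) − M_{k−1}(i,k) · M_{k−1}(k,j). In particular, p_{k−1} divides M_{k−1}(k,k)·M_{k−1}(i,j) − M_{k−1}(i,k)·M_{k−1}(k,j) in R, with quotient equal to the bordered minor M_k(i,j). -/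
open Matrix

/-- The bordered minor `M_m(i,j)`: the determinant of the `(m+1)×(m+1)` submatrix of `A`
consisting of the leading `m` rows together with row `i`, and the leading `m` columns
together with column `j` (0-based: rows `0,…,m−1,i` and columns `0,…,m−1,j`). -/
def borderedMinor {R : Type*} [CommRing R] {n : ℕ} (A : Matrix (Fin n) (Fin n) R)
    (m : ℕ) (hm : m ≤ n) (i j : Fin n) : R :=
  (A.submatrix (Fin.snoc (Fin.castLE hm) i) (Fin.snoc (Fin.castLE hm) j)).det

/-- The leading principal `m×m` minor `p_m` of `A`. -/
def leadingMinor {R : Type*} [CommRing R] {n : ℕ} (A : Matrix (Fin n) (Fin n) R)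
    (m : ℕ) (hm : m ≤ n) : R :=
  (A.submatrix (Fin.castLE hm) (Fin.castLE hm)).det

namespace Matrix

variable {R m q : Type*} [CommRing R] [Fintype m] [DecidableEq m]

/-- Fraction-free version of the Schur complement formula. -/
theorem det_pow_card_mul_det_fromBlocks [Fintype q] [DecidableEq q] (P : Matrix m m R)
    (B : Matrix m q R) (C : Matrix q m R) (D : Matrix q q R) :
    P.det ^ Fintype.card q * (fromBlocks P B C D).det =
      P.det * (P.det • D - C * P.adjugate * B).det := by
  have h : fromBlocks 1 0 (-(C * P.adjugate)) (P.det • (1 : Matrix q q R)) *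
      fromBlocks P B C D = fromBlocks P B 0 (P.det • D - C * P.adjugate * B) := by
    rw [fromBlocks_multiply]
    congr 1
    · simp
    · simp
    · simp [Matrix.mul_assoc, adjugate_mul]
    · simp [sub_eq_neg_add]
  have hdet := congrArg det h
  rwa [det_mul, det_fromBlocks_zero₁₂, det_fromBlocks_zero₂₁, det_one, one_mul, det_smul,
    det_one, mul_one] at hdet

/-- The minor of `N` bordering its upper left block with one further row and column. -/
def blockBorderedMinor (N : Matrix (m ⊕ q) (m ⊕ q) R) (r c : q) : R :=
  (N.submatrix (Sum.map id fun _ : Fin 1 => r) (Sum.map id fun _ : Fin 1 => c)).det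

theorem blockBorderedMinor_eq_of_isLeftRegular {N : Matrix (m ⊕ q) (m ⊕ q) R}
    (h : IsLeftRegular N.toBlocks₁₁.det) (r c : q) :
    N.blockBorderedMinor r c = (N.toBlocks₁₁.det • N.toBlocks₂₂ -
      N.toBlocks₂₁ * N.toBlocks₁₁.adjugate * N.toBlocks₁₂) r c := by
  apply h
  have key := det_pow_card_mul_det_fromBlocks N.toBlocks₁₁
    (N.toBlocks₁₂.submatrix id fun _ : Fin 1 => c) (N.toBlocks₂₁.submatrix (fun _ : Fin 1 => r) id)
    (N.toBlocks₂₂.submatrix (fun _ : Fin 1 => r) fun _ : Fin 1 => c)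
  rw [Fintype.card_fin, pow_one, det_fin_one] at key
  have hN : N.submatrix (Sum.map id fun _ : Fin 1 => r) (Sum.map id fun _ : Fin 1 => c) =
      fromBlocks N.toBlocks₁₁
        (N.toBlocks₁₂.submatrix id fun _ : Fin 1 => c)
        (N.toBlocks₂₁.submatrix (fun _ : Fin 1 => r) id)
        (N.toBlocks₂₂.submatrix (fun _ : Fin 1 => r) fun _ : Fin 1 => c) := by
    ext (_ | _) (_ | _) <;> rfl
  rw [blockBorderedMinor, hN]
  exact key

theorem det_toBlocks₁₁_mul_det_of_isLeftRegular {N : Matrix (m ⊕ Fin 2) (m ⊕ Fin 2) R}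
    (h : IsLeftRegular N.toBlocks₁₁.det) :
    N.toBlocks₁₁.det * N.det =
      N.blockBorderedMinor 0 0 * N.blockBorderedMinor 1 1 -
        N.blockBorderedMinor 0 1 * N.blockBorderedMinor 1 0 := by
  apply h
  have key := det_pow_card_mul_det_fromBlocks N.toBlocks₁₁ N.toBlocks₁₂ N.toBlocks₂₁ N.toBlocks₂₂
  rw [Fintype.card_fin, fromBlocks_toBlocks, det_fin_two] at key
  simp only [blockBorderedMinor_eq_of_isLeftRegular h]
  rw [← key, pow_two, mul_assoc]

theorem _root_.RingHom.map_blockBorderedMinor {S : Type*} [CommRing S] (f : R →+* S)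
    (N : Matrix (m ⊕ q) (m ⊕ q) R) (r c : q) :
    f (N.blockBorderedMinor r c) = (N.map f).blockBorderedMinor r c := by
  rw [blockBorderedMinor, RingHom.map_det]
  rfl

/-- Sylvester's identity for a block matrix whose lower right block has size two. The general case
follows from the regular one by adding an indeterminate to the diagonal of the upper left block. -/
theorem det_toBlocks₁₁_mul_det (N : Matrix (m ⊕ Fin 2) (m ⊕ Fin 2) R) :
    N.toBlocks₁₁.det * N.det =
      N.blockBorderedMinor 0 0 * N.blockBorderedMinor 1 1 -
        N.blockBorderedMinor 0 1 * N.blockBorderedMinor 1 0 := by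
  let N' : Matrix (m ⊕ Fin 2) (m ⊕ Fin 2) (Polynomial R) :=
    fromBlocks (charmatrix (-N.toBlocks₁₁)) (N.toBlocks₁₂.map Polynomial.C)
      (N.toBlocks₂₁.map Polynomial.C) (N.toBlocks₂₂.map Polynomial.C)
  have hreg : IsLeftRegular N'.toBlocks₁₁.det := by
    rw [toBlocks_fromBlocks₁₁]
    exact (charpoly_monic (-N.toBlocks₁₁)).isRegular.left
  have hN : (Polynomial.evalRingHom 0).mapMatrix N' = N := by
    ext (a | a) (b | b)
    · by_cases hab : a = b <;> simp [N', hab, toBlocks₁₁]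
    all_goals simp [N', toBlocks₁₂, toBlocks₂₁, toBlocks₂₂]
  have hP : (Polynomial.evalRingHom 0).mapMatrix N'.toBlocks₁₁ = N.toBlocks₁₁ :=
    congrArg toBlocks₁₁ hN
  have key := congrArg (Polynomial.evalRingHom 0) (det_toBlocks₁₁_mul_det_of_isLeftRegular hreg)
  simpa only [map_mul, map_sub, RingHom.map_blockBorderedMinor, RingHom.map_det,
    ← RingHom.mapMatrix_apply, hN, hP] using key

end Matrix

theorem borderedMinor_eq_det_submatrix_sumElim {R : Type*} [CommRing R] {n : ℕ}
    (A : Matrix (Fin n) (Fin n) R) (m : ℕ) (hm : m ≤ n) (i j : Fin n) :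
    borderedMinor A m hm i j =
      (A.submatrix (Sum.elim (Fin.castLE hm) fun _ : Fin 1 => i)
        (Sum.elim (Fin.castLE hm) fun _ : Fin 1 => j)).det := by
  have h (l : Fin n) : (Fin.snoc (Fin.castLE hm) l : Fin (m + 1) → Fin n) ∘ finSumFinEquiv =
      Sum.elim (Fin.castLE hm) fun _ : Fin 1 => l := by
    ext (a | a)
    · exact congrArg Fin.val (Fin.snoc_castSucc (α := fun _ => Fin n) l (Fin.castLE hm) a)
    · obtain rfl := Subsingleton.elim a 0
      exact congrArg Fin.val (Fin.snoc_last (α := fun _ => Fin n) l (Fin.castLE hm))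
  rw [borderedMinor, ← det_submatrix_equiv_self finSumFinEquiv, submatrix_submatrix, h, h]

theorem borderedMinor_succ_eq_det_submatrix_sumElim {R : Type*} [CommRing R] {n : ℕ}
    (A : Matrix (Fin n) (Fin n) R) (m : ℕ) (hm : m + 1 ≤ n) (i j : Fin n) :
    borderedMinor A (m + 1) hm i j =
      (A.submatrix (Sum.elim (Fin.castLE (Nat.le_of_succ_le hm)) ![⟨m, hm⟩, i])
        (Sum.elim (Fin.castLE (Nat.le_of_succ_le hm)) ![⟨m, hm⟩, j])).det := by
  have h (l : Fin n) :
      (Fin.snoc (Fin.castLE hm) l : Fin (m + 1 + 1) → Fin n) ∘ (finSumFinEquiv (m := m) (n := 2)) =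
        Sum.elim (Fin.castLE (Nat.le_of_succ_le hm)) ![⟨m, hm⟩, l] := by
    ext (a | a)
    · exact congrArg Fin.val
        (Fin.snoc_castSucc (α := fun _ => Fin n) l (Fin.castLE hm) a.castSucc)
    · fin_cases a
      · exact congrArg Fin.val
          (Fin.snoc_castSucc (α := fun _ => Fin n) l (Fin.castLE hm) (Fin.last m))
      · exact congrArg Fin.val (Fin.snoc_last (α := fun _ => Fin n) l (Fin.castLE hm))
  rw [borderedMinor, ← det_submatrix_equiv_self (finSumFinEquiv (m := m) (n := 2)),
    submatrix_submatrix, h, h]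

theorem leadingMinor_mul_borderedMinor_succ {R : Type*} [CommRing R] {n : ℕ}
    (A : Matrix (Fin n) (Fin n) R) (m : ℕ) (hm : m + 1 ≤ n) (i j : Fin n) :
    leadingMinor A m (Nat.le_of_succ_le hm) * borderedMinor A (m + 1) hm i j =
      borderedMinor A m (Nat.le_of_succ_le hm) ⟨m, hm⟩ ⟨m, hm⟩ *
          borderedMinor A m (Nat.le_of_succ_le hm) i j -
        borderedMinor A m (Nat.le_of_succ_le hm) i ⟨m, hm⟩ *
          borderedMinor A m (Nat.le_of_succ_le hm) ⟨m, hm⟩ j := by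
  let rows : Fin m ⊕ Fin 2 → Fin n := Sum.elim (Fin.castLE (Nat.le_of_succ_le hm)) ![⟨m, hm⟩, i]
  let cols : Fin m ⊕ Fin 2 → Fin n := Sum.elim (Fin.castLE (Nat.le_of_succ_le hm)) ![⟨m, hm⟩, j]
  have hminor (r c : Fin 2) : (A.submatrix rows cols).blockBorderedMinor r c =
      borderedMinor A m (Nat.le_of_succ_le hm) (![⟨m, hm⟩, i] r) (![⟨m, hm⟩, j] c) := by
    rw [borderedMinor_eq_det_submatrix_sumElim, blockBorderedMinor, submatrix_submatrix,
      Sum.elim_comp_map, Sum.elim_comp_map]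
    rfl
  have key := det_toBlocks₁₁_mul_det (A.submatrix rows cols)
  simp only [hminor] at key
  rw [borderedMinor_succ_eq_det_submatrix_sumElim,
    mul_comm (borderedMinor A m _ i _)]
  exact key

/-- Sylvester's determinant identity underlying Bareiss's fraction-free
Gaussian elimination.  For `1 ≤ k ≤ n − 1` (1-based) and row/column indices `i, j > k`
(1-based, so 0-based `i, j ≥ k`), with `κ` the 0-based index of the 1-based row/column `k`:
`p_{k−1} · M_k(i,j) = M_{k−1}(κ,κ) · M_{k−1}(i,j) − M_{k−1}(i,κ) · M_{k−1}(κ,j)`;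
in particular `p_{k−1}` divides the right-hand side with quotient `M_k(i,j)`. -/
theorem sylvester_identity_bareiss
    {R : Type*} [CommRing R] {n : ℕ} (A : Matrix (Fin n) (Fin n) R)
    (k : ℕ) (hk1 : 1 ≤ k) (hk2 : k ≤ n - 1)
    (i j : Fin n) (hi : k ≤ (i : ℕ)) (hj : k ≤ (j : ℕ)) :
    leadingMinor A (k - 1) (by omega) * borderedMinor A k (by omega) i j =
        borderedMinor A (k - 1) (by omega) ⟨k - 1, by omega⟩ ⟨k - 1, by omega⟩ *
            borderedMinor A (k - 1) (by omega) i j -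
          borderedMinor A (k - 1) (by omega) i ⟨k - 1, by omega⟩ *
            borderedMinor A (k - 1) (by omega) ⟨k - 1, by omega⟩ j ∧
      leadingMinor A (k - 1) (by omega) ∣
        borderedMinor A (k - 1) (by omega) ⟨k - 1, by omega⟩ ⟨k - 1, by omega⟩ *
            borderedMinor A (k - 1) (by omega) i j -
          borderedMinor A (k - 1) (by omega) i ⟨k - 1, by omega⟩ *
            borderedMinor A (k - 1) (by omega) ⟨k - 1, by omega⟩ j := by
  obtain ⟨m, rfl⟩ := Nat.exists_eq_add_of_le' hk1
  have h := leadingMinor_mul_borderedMinor_succ A m (by omega) i j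
  exact ⟨h, Dvd.intro _ h⟩
end

section
/- Let D be an integral domain with field of fractions K, let m, n, r be positive integers with r ≤ min(m,n), and suppose A = P_w · L · Δ⁻¹ · U · P_c where: P_w and P_c are permutation matrices of sizes m and n; L is an m×r matrix over D; Δ is an invertible r×r diagonal matrix over D; U is an r×n matrix over D in upper echelon form whose diagonal entries U_{k,k} are nonzero and satisfy U_{k,k} ∣ Δ_{k,k} in D for each k = 1,…,r. Suppose d_1,…,d_r ∈ D are nonzero elements such that d_k divides every entry of the k-th row of U. Set D_U = diag(d_1,…,d_r). Then: (i) d_k divides Δ_{k,k} in D for each k, so that the matrices Û = D_U⁻¹·U and Δ̂ = Δ·D_U⁻¹ have all entries in D; and (ii) A = P_w · L · Δ̂⁻¹ · Û · P_c. -/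
open Matrix

/-- The inverse of a diagonal matrix over a field with nonzero diagonal entries is the diagonal
matrix of the inverses. -/
theorem inv_diagonal_of_ne_zero {ι F : Type*} [Fintype ι] [DecidableEq ι] [Field F] {v : ι → F}
    (hv : ∀ i, v i ≠ 0) :
    (Matrix.diagonal v)⁻¹ = Matrix.diagonal fun i => (v i)⁻¹ := by
  refine Matrix.inv_eq_right_inv ?_
  rw [Matrix.diagonal_mul_diagonal, ← Matrix.diagonal_one]
  exact congrArg Matrix.diagonal (funext fun i => mul_inv_cancel₀ (hv i))

/-- cancelling common row factors from the fraction-free `L D⁻¹ U`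
decomposition.  Over an integral domain `R` with fraction field `FractionRing R`,
suppose `A = P_w · L · Δ⁻¹ · U · P_c`, where `P_w`, `P_c` are permutation matrices,
`L` is `m×r` over `R`, `Δ = diag(δ_1,…,δ_r)` with nonzero `δ_k`, and `U` is `r×n`
over `R`, upper echelon with nonzero diagonal entries (pivots) dividing the `δ_k`.
If each nonzero `d_k ∈ R` divides every entry of the `k`-th row of `U`, then
(i) `d_k ∣ δ_k` in `R`, the matrices `Û = D_U⁻¹ · U` and `Δ̂ = Δ · D_U⁻¹` have all
their entries in (the image of) `R`, and (ii) `A = P_w · L · Δ̂⁻¹ · Û · P_c`. -/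
theorem LDU_cancel_row_factors
    {R : Type*} [CommRing R] [IsDomain R] {m n r : ℕ}
    (hm : 0 < m) (hn : 0 < n) (hr : 0 < r) (hrm : r ≤ m) (hrn : r ≤ n)
    (σw : Equiv.Perm (Fin m)) (σc : Equiv.Perm (Fin n))
    (L : Matrix (Fin m) (Fin r) R) (δ : Fin r → R) (U : Matrix (Fin r) (Fin n) R)
    (A : Matrix (Fin m) (Fin n) (FractionRing R))
    (hδ : ∀ k : Fin r, δ k ≠ 0)
    (hUech : ∀ (k : Fin r) (j : Fin n), (j : ℕ) < (k : ℕ) → U k j = 0)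
    (hUpiv : ∀ k : Fin r, U k (Fin.castLE hrn k) ≠ 0)
    (hUdvd : ∀ k : Fin r, U k (Fin.castLE hrn k) ∣ δ k)
    (hA : A = σw.permMatrix (FractionRing R) *
        L.map (algebraMap R (FractionRing R)) *
        (Matrix.diagonal fun k => algebraMap R (FractionRing R) (δ k))⁻¹ *
        U.map (algebraMap R (FractionRing R)) *
        σc.permMatrix (FractionRing R))
    (d : Fin r → R) (hd0 : ∀ k : Fin r, d k ≠ 0)
    (hd : ∀ (k : Fin r) (j : Fin n), d k ∣ U k j) :
    (∀ k : Fin r, d k ∣ δ k) ∧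
    (∀ (k : Fin r) (j : Fin n),
      ((Matrix.diagonal fun k => algebraMap R (FractionRing R) (d k))⁻¹ *
          U.map (algebraMap R (FractionRing R))) k j ∈
        Set.range (algebraMap R (FractionRing R))) ∧
    (∀ k l : Fin r,
      ((Matrix.diagonal fun k => algebraMap R (FractionRing R) (δ k)) *
          (Matrix.diagonal fun k => algebraMap R (FractionRing R) (d k))⁻¹) k l ∈
        Set.range (algebraMap R (FractionRing R))) ∧
    A = σw.permMatrix (FractionRing R) *
        L.map (algebraMap R (FractionRing R)) *
        ((Matrix.diagonal fun k => algebraMap R (FractionRing R) (δ k)) *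
          (Matrix.diagonal fun k => algebraMap R (FractionRing R) (d k))⁻¹)⁻¹ *
        ((Matrix.diagonal fun k => algebraMap R (FractionRing R) (d k))⁻¹ *
          U.map (algebraMap R (FractionRing R))) *
        σc.permMatrix (FractionRing R) := by
  have map_ne_zero {x : R} (hx : x ≠ 0) : algebraMap R (FractionRing R) x ≠ 0 :=
    (map_ne_zero_iff _ (IsFractionRing.injective R (FractionRing R))).2 hx
  have mem_range {a b : R} (ha : a ≠ 0) (hab : a ∣ b) :
      (algebraMap R (FractionRing R) a)⁻¹ * algebraMap R (FractionRing R) b ∈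
        Set.range (algebraMap R (FractionRing R)) := by
    obtain ⟨c, rfl⟩ := hab
    exact ⟨c, by rw [map_mul, inv_mul_cancel_left₀ (map_ne_zero ha)]⟩
  have hdδ (k : Fin r) : d k ∣ δ k := (hd k _).trans (hUdvd k)
  have hδ' (k : Fin r) := map_ne_zero (hδ k)
  have hd' (k : Fin r) := map_ne_zero (hd0 k)
  rw [inv_diagonal_of_ne_zero hd', Matrix.diagonal_mul_diagonal,
    inv_diagonal_of_ne_zero fun k => mul_ne_zero (hδ' k) (inv_ne_zero (hd' k))]
  refine ⟨hdδ, fun k j => ?_, fun k l => ?_, ?_⟩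
  · rw [Matrix.diagonal_mul, Matrix.map_apply]
    exact mem_range (hd0 k) (hd k j)
  · rw [Matrix.diagonal_apply]
    split_ifs
    · rw [mul_comm]
      exact mem_range (hd0 k) (hdδ k)
    · exact ⟨0, map_zero _⟩
  · rw [hA, inv_diagonal_of_ne_zero hδ', ← Matrix.mul_assoc _ (Matrix.diagonal _) (U.map _),
      Matrix.mul_assoc _ (Matrix.diagonal _) (Matrix.diagonal _), Matrix.diagonal_mul_diagonal]
    congr! 5 with k
    have := hd' k
    have := hδ' k
    field_simp
end

section
/- Let K be a field, m, n positive integers, r ≤ min(m,n), A an m×n matrix over K, M an invertible m×m matrix over K, and P_c an n×n permutation matrix. Write M in block form with V its first r rows and W its last m−r rows, and suppose M·A = [[U, B],[0, 0]]·P_c, where U is r×r, B is r×(n−r), and the bottom m−r rows are zero. Then for every b ∈ K^m and x ∈ K^n, writing P_c·x = (y, z) with y ∈ K^r and z ∈ K^{n−r}, we have: A·x = b if and only if W·b = 0 and U·y + B·z = V·b. -/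
open Matrix

/-- Let `A` be an `m×n` matrix over a field `K` (with `m = r + mr`,
`n = r + nr`, so `r ≤ min(m,n)`; rows are indexed by `Fin r ⊕ Fin mr` and columns by
`Fin r ⊕ Fin nr`), `M` an invertible `m×m` matrix and `P_c` a permutation matrix with
`M · A = [[U, B], [0, 0]] · P_c`.  Writing `V` for the first `r` rows of `M`, `W` for
the last `m − r` rows, and `P_c · x = (y, z)`, we have
`A · x = b ↔ (W · b = 0 ∧ U · y + B · z = V · b)`. -/
theorem solve_compatibility_iff
    {K : Type*} [Field K] {r mr nr : ℕ}
    (hm : 0 < r + mr) (hn : 0 < r + nr)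
    (A : Matrix (Fin r ⊕ Fin mr) (Fin r ⊕ Fin nr) K)
    (M : Matrix (Fin r ⊕ Fin mr) (Fin r ⊕ Fin mr) K) (hM : IsUnit M.det)
    (σc : Equiv.Perm (Fin r ⊕ Fin nr))
    (U : Matrix (Fin r) (Fin r) K) (B : Matrix (Fin r) (Fin nr) K)
    (hMA : M * A = Matrix.fromBlocks U B 0 0 * σc.permMatrix K)
    (b : (Fin r ⊕ Fin mr) → K) (x : (Fin r ⊕ Fin nr) → K) :
    A *ᵥ x = b ↔
      ((M.submatrix Sum.inr id) *ᵥ b = 0 ∧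
        U *ᵥ (fun i : Fin r => (σc.permMatrix K *ᵥ x) (Sum.inl i)) +
            B *ᵥ (fun i : Fin nr => (σc.permMatrix K *ᵥ x) (Sum.inr i)) =
          (M.submatrix Sum.inl id) *ᵥ b) := by
  have hinj : Function.Injective M.mulVec :=
    mulVec_injective_of_isUnit ((isUnit_iff_isUnit_det M).2 hM)
  have hl : (M.submatrix Sum.inl id) *ᵥ b = fun i => (M *ᵥ b) (Sum.inl i) := rfl
  have hr : (M.submatrix Sum.inr id) *ᵥ b = fun i => (M *ᵥ b) (Sum.inr i) := rfl
  rw [← hinj.eq_iff, mulVec_mulVec, hMA, ← mulVec_mulVec, fromBlocks_mulVec, hl, hr]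
  simp only [funext_iff, Sum.forall, Sum.elim_inl, Sum.elim_inr, zero_mulVec, add_zero,
    Pi.zero_apply]
  rw [and_comm]
  exact and_congr_left' (forall_congr' fun _ => eq_comm)
end

section
/- Let K be a field, m, n positive integers, r ≤ min(m,n), A an m×n matrix over K, M an invertible m×m matrix over K, and P_c an n×n permutation matrix. Write M in block form with V its first r rows and W its last m−r rows, and suppose M·A = [[U, B],[0, 0]]·P_c with U an invertible r×r matrix. Let X be an r×r matrix over K such that X·U = Δ is an invertible diagonal matrix. Let b ∈ K^m satisfy W·b = 0 and define x₀ = P_c⁻¹·(Δ⁻¹·X·V·b, 0), the vector whose image under P_c has first r coordinates Δ⁻¹ X V b and last n−r coordinates 0. Then A·x₀ = b. -/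
open Matrix

/-- With `M · A = [[U, B], [0, 0]] · P_c` as in the fraction-free solving
algorithm (`M` invertible, `U` invertible `r×r`), let `X` satisfy `X · U = Δ` with `Δ`
an invertible diagonal matrix.  If `b` satisfies the compatibility condition `W · b = 0`
(`W` = last `m − r` rows of `M`), then `x₀ = P_c⁻¹ · (Δ⁻¹ X V b, 0)` (`V` = first `r`
rows of `M`) is a particular solution: `A · x₀ = b`. -/
theorem solve_particular_solution
    {K : Type*} [Field K] {r mr nr : ℕ}
    (hm : 0 < r + mr) (hn : 0 < r + nr)
    (A : Matrix (Fin r ⊕ Fin mr) (Fin r ⊕ Fin nr) K)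
    (M : Matrix (Fin r ⊕ Fin mr) (Fin r ⊕ Fin mr) K) (hM : IsUnit M.det)
    (σc : Equiv.Perm (Fin r ⊕ Fin nr))
    (U : Matrix (Fin r) (Fin r) K) (B : Matrix (Fin r) (Fin nr) K)
    (hU : IsUnit U.det)
    (hMA : M * A = Matrix.fromBlocks U B 0 0 * σc.permMatrix K)
    (X Δ : Matrix (Fin r) (Fin r) K)
    (hXU : X * U = Δ) (hΔdiag : Δ.IsDiag) (hΔ : IsUnit Δ.det)
    (b : (Fin r ⊕ Fin mr) → K)
    (hb : (M.submatrix Sum.inr id) *ᵥ b = 0) :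
    A *ᵥ ((σc.permMatrix K)⁻¹ *ᵥ
        Sum.elim (Δ⁻¹ *ᵥ (X *ᵥ ((M.submatrix Sum.inl id) *ᵥ b))) (fun _ => 0)) = b := by
  have hP : IsUnit (σc.permMatrix K).det := by
    rw [det_permutation]
    exact (Equiv.Perm.sign σc).isUnit.map (Int.castRingHom K)
  have hinv : U * Δ⁻¹ * X = 1 := by
    rw [Matrix.mul_assoc, mul_eq_one_comm, Matrix.mul_assoc, hXU, nonsing_inv_mul _ hΔ]
  apply mulVec_injective_of_isUnit ((isUnit_iff_isUnit_det M).mpr hM)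
  rw [mulVec_mulVec, hMA, mulVec_mulVec, Matrix.mul_assoc, mul_nonsing_inv _ hP, Matrix.mul_one,
    fromBlocks_mulVec]
  have hzero : (fun _ : Fin nr => (0 : K)) = 0 := rfl
  simp only [Sum.elim_comp_inl, Sum.elim_comp_inr, hzero, mulVec_zero, zero_mulVec, add_zero]
  rw [mulVec_mulVec, mulVec_mulVec, hinv, one_mulVec]
  ext (i | i)
  · rfl
  · exact (congrFun hb i).symm
end

section
/- Let K be a field, m, n positive integers, r ≤ min(m,n), A an m×n matrix over K, M an invertible m×m matrix over K, and P_c an n×n permutation matrix. Suppose M·A = [[U, B],[0, 0]]·P_c with U an invertible r×r matrix and B an r×(n−r) matrix. Let X be an r×r matrix over K such that X·U = Δ is an invertible diagonal matrix, and define the n×(n−r) matrix N = P_c⁻¹·[[−Δ⁻¹·X·B],[I_{n−r}]] (top block −Δ⁻¹XB of size r×(n−r), bottom block the (n−r)×(n−r) identity). Then the columns of N are linearly independent and the kernel {x ∈ K^n : A·x = 0} equals the column space of N. -/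
open Matrix

/-- The kernel of `[[U, B], [0, 0]]` with `V` a left inverse of `U` is the column space of
`[[-V B], [1]]`. -/
theorem Matrix.fromBlocks_zero_zero_mulVec_eq_zero_iff {K k l m : Type*} [CommRing K]
    [Fintype k] [DecidableEq k] [Fintype l] [DecidableEq l]
    {U V : Matrix k k K} (hVU : V * U = 1) (B : Matrix k l K) (y : k ⊕ l → K) :
    fromBlocks U B (0 : Matrix m k K) (0 : Matrix m l K) *ᵥ y = 0 ↔
      fromRows (-(V * B)) (1 : Matrix l l K) *ᵥ (y ∘ Sum.inr) = y := by
  have hUV : U * V = 1 := mul_eq_one_comm.mp hVU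
  rw [fromBlocks_mulVec, fromRows_mulVec]
  constructor
  · intro h
    have h₁ : U *ᵥ (y ∘ Sum.inl) + B *ᵥ (y ∘ Sum.inr) = 0 :=
      funext fun i => congrFun h (Sum.inl i)
    have h₂ : y ∘ Sum.inl = -((V * B) *ᵥ (y ∘ Sum.inr)) := by
      rw [← mulVec_mulVec, ← mulVec_neg, ← eq_neg_of_add_eq_zero_left h₁, mulVec_mulVec, hVU,
        one_mulVec]
    rw [neg_mulVec, one_mulVec, ← h₂, Sum.elim_comp_inl_inr]
  · intro h
    have h₁ : y ∘ Sum.inl = -((V * B) *ᵥ (y ∘ Sum.inr)) := by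
      rw [← neg_mulVec]
      exact funext fun i => (congrFun h (Sum.inl i)).symm
    rw [h₁, mulVec_neg, mulVec_mulVec, ← Matrix.mul_assoc, hUV, Matrix.one_mul]
    ext (i | i) <;> simp

/-- With `M · A = [[U, B], [0, 0]] · P_c` as in the fraction-free solving
algorithm (`M` invertible, `U` invertible `r×r`), let `X` satisfy `X · U = Δ` with `Δ`
an invertible diagonal matrix, and set `N = P_c⁻¹ · [[−Δ⁻¹ X B], [I]]`.  Then the
columns of `N` are linearly independent and the kernel `{x : A x = 0}` is exactly the
column space of `N`. -/
theorem solve_nullspace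
    {K : Type*} [Field K] {r mr nr : ℕ}
    (hm : 0 < r + mr) (hn : 0 < r + nr)
    (A : Matrix (Fin r ⊕ Fin mr) (Fin r ⊕ Fin nr) K)
    (M : Matrix (Fin r ⊕ Fin mr) (Fin r ⊕ Fin mr) K) (hM : IsUnit M.det)
    (σc : Equiv.Perm (Fin r ⊕ Fin nr))
    (U : Matrix (Fin r) (Fin r) K) (B : Matrix (Fin r) (Fin nr) K)
    (hU : IsUnit U.det)
    (hMA : M * A = Matrix.fromBlocks U B 0 0 * σc.permMatrix K)
    (X Δ : Matrix (Fin r) (Fin r) K)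
    (hXU : X * U = Δ) (hΔdiag : Δ.IsDiag) (hΔ : IsUnit Δ.det)
    (N : Matrix (Fin r ⊕ Fin nr) (Fin nr) K)
    (hN : N = (σc.permMatrix K)⁻¹ *
        Matrix.fromRows (-(Δ⁻¹ * (X * B))) (1 : Matrix (Fin nr) (Fin nr) K)) :
    LinearIndependent K (fun j : Fin nr => Nᵀ j) ∧
      {x : (Fin r ⊕ Fin nr) → K | A *ᵥ x = 0} = Set.range N.mulVec := by
  have hP : IsUnit (σc.permMatrix K).det := by
    rw [det_permutation]
    exact (Units.isUnit (Equiv.Perm.sign σc)).map (Int.castRingHom K)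
  have hVU : Δ⁻¹ * X * U = 1 := by rw [Matrix.mul_assoc, hXU, nonsing_inv_mul _ hΔ]
  rw [← Matrix.mul_assoc] at hN
  have hPN : σc.permMatrix K * N = fromRows (-(Δ⁻¹ * X * B)) 1 := by
    rw [hN, ← Matrix.mul_assoc, mul_nonsing_inv _ hP, Matrix.one_mul]
  have hA (x) : A *ᵥ x = 0 ↔
      N *ᵥ ((σc.permMatrix K *ᵥ x) ∘ Sum.inr) = x := by
    rw [← (mulVec_injective_of_isUnit ((isUnit_iff_isUnit_det _).mpr hM)).eq_iff,
      mulVec_zero, mulVec_mulVec, hMA, ← mulVec_mulVec,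
      fromBlocks_zero_zero_mulVec_eq_zero_iff hVU, ← hPN, ← mulVec_mulVec,
      (mulVec_injective_of_isUnit ((isUnit_iff_isUnit_det _).mpr hP)).eq_iff]
  have hinr (c : Fin nr → K) : (σc.permMatrix K *ᵥ (N *ᵥ c)) ∘ Sum.inr = c := by
    rw [mulVec_mulVec, hPN, fromRows_mulVec, Sum.elim_comp_inr, one_mulVec]
  refine ⟨mulVec_injective_iff.mp fun c d h => ?_, Set.ext fun x => ⟨fun h => ⟨_, (hA x).mp h⟩, ?_⟩⟩
  · rw [← hinr c, ← hinr d]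
    exact congrArg (fun y => (σc.permMatrix K *ᵥ y) ∘ Sum.inr) h
  · rintro ⟨c, rfl⟩
    exact (hA _).mpr (congrArg N.mulVec (hinr c))
end
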